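/- There exist constants C > 0 and λ₀ > 0 such that for all real λ ≥ λ₀ and all natural numbers l with l ≤ λ − √λ, |1/D_λ(l) − (1 − l/λ) − 1/(λ·(1 − l/λ))| ≤ C·(1/λ + 1/(λ²·(1 − l/λ)³)). -/

import Mathlib

/-- `D lam l = ∑_{k=0}^{l} l! / ((l-k)! * lam^k)`. -/
noncomputable def D (lam : ℝ) (l : ℕ) : ℝ :=
  ∑ k ∈ Finset.range (l + 1),
    (Nat.factorial l : ℝ) / ((Nat.factorial (l - k) : ℝ) * lam ^ k)

lemma D_zero (lam : ℝ) : D lam 0 = 1 := by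
  simp [D]

lemma D_succ (lam : ℝ) (l : ℕ) :
    D lam (l + 1) = 1 + ((l : ℝ) + 1) / lam * D lam l := by
  unfold D
  rw [Finset.sum_range_succ', Finset.mul_sum, add_comm]
  congr 1
  · have := Nat.cast_ne_zero (R := ℝ).mpr (Nat.factorial_ne_zero (l + 1))
    simp only [Nat.sub_zero, pow_zero, mul_one]
    exact div_self this
  · refine Finset.sum_congr rfl fun k _ => ?_
    rw [Nat.add_sub_add_right, Nat.factorial_succ, div_mul_div_comm, pow_succ]
    push_cast
    ring

lemma D_pos {lam : ℝ} (hlam : 0 < lam) (l : ℕ) : 0 < D lam l := by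
  induction l with
  | zero => simp [D_zero]
  | succ l ih => rw [D_succ]; positivity

lemma one_div_D_succ {lam : ℝ} (hlam : 0 < lam) (l : ℕ) :
    1 / D lam (l + 1) = (1 / D lam l) / (1 / D lam l + ((l : ℝ) + 1) / lam) := by
  have h := D_pos hlam l
  rw [D_succ]
  field_simp

/-- The function `ε ↦ ε + δ / ε` is a supersolution of the recursion for `1 / D`. -/
lemma upper_step {e d b : ℝ} (he : 0 < e) (he1 : e ≤ 1) (hd : 0 < d) (hb : 0 < b)
    (h : b ≤ (e + d) + d / (e + d)) : b / (b + (1 - e)) ≤ e + d / e := by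
  rw [div_le_iff₀ (by linarith)]
  set U := e + d / e with hU
  have hU0 : 0 < U := by positivity
  rcases le_total 1 U with h1 | h1
  · nlinarith [mul_nonneg hU0.le (sub_nonneg.2 he1)]
  have key : (e + d) + d / (e + d) - U ≤ U * ((e + d) + d / (e + d) - e) := by
    have : U * ((e + d) + d / (e + d) - e) - ((e + d) + d / (e + d) - U)
        = d * (e + d / e + d * (1 - e) / (e * (e + d)) + d / (e * (e + d))) := by
      rw [hU]; field_simp; ring
    have h2 : 0 ≤ 1 - e := by linarith
    have : 0 ≤ d * (e + d / e + d * (1 - e) / (e * (e + d)) + d / (e * (e + d))) := by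
      positivity
    linarith
  nlinarith [mul_le_mul_of_nonneg_right h (sub_nonneg.2 h1)]

/-- The function `ε ↦ ε + δ / ε - 16 (δ + δ² / ε³)` is a subsolution of the recursion
for `1 / D`. -/
lemma lower_step {e d b : ℝ} (he : 0 < e) (he1 : e ≤ 1) (hd : 0 < d) (hde : d ≤ e ^ 2)
    (hb : 0 < b)
    (h : (e + d) + d / (e + d) - 16 * (d + d ^ 2 / (e + d) ^ 3) ≤ b) :
    e + d / e - 16 * (d + d ^ 2 / e ^ 3) ≤ b / (b + (1 - e)) := by
  rw [le_div_iff₀ (by linarith)]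
  set L := e + d / e - 16 * (d + d ^ 2 / e ^ 3) with hL
  set L' := (e + d) + d / (e + d) - 16 * (d + d ^ 2 / (e + d) ^ 3) with hL'
  rcases le_total L 0 with h0 | h0
  · nlinarith
  have hq : 0 ≤ d ^ 2 / e ^ 3 := by positivity
  have hL1 : L ≤ 1 := by
    have : e + d / e - 16 * d ≤ 1 := by
      have h3 : d / e ≤ 1 - e + 16 * d := by
        rw [div_le_iff₀ he]
        rcases le_total e (1 / 2) with h4 | h4 <;> nlinarith [mul_pos hd he]
      linarith
    linarith
  have hLle : L ≤ e + d / e := by linarith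
  have hd_e : d ≤ e := by nlinarith
  have hs : d / e ^ 2 ≤ 1 := by rw [div_le_one (by positivity)]; exact hde
  have hdiff : d * (1 - d / e ^ 2) ≤ L' - L := by
    have h1 : d ^ 2 / (e + d) ^ 3 ≤ d ^ 2 / e ^ 3 := by gcongr; linarith
    have h2 : d / e - d / (e + d) ≤ d * (d / e ^ 2) := by
      have : d / e - d / (e + d) = d * (d / (e * (e + d))) := by field_simp; ring
      rw [this]
      gcongr
      nlinarith
    rw [hL, hL']
    linarith
  have hprod : L * (L' - e) ≤ d * (1 - d / e ^ 2) := by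
    have hM : L' - e ≤ d * (1 / e - 2 * d / e ^ 3) := by
      have h1 : d / (e + d) ≤ d / e := by gcongr; linarith
      have h2 : d ^ 2 / (2 * e) ^ 3 ≤ d ^ 2 / (e + d) ^ 3 := by gcongr; linarith
      have h3 : d ^ 2 / (2 * e) ^ 3 = d ^ 2 / e ^ 3 / 8 := by field_simp; norm_num
      have h4 : d * (1 / e - 2 * d / e ^ 3) = d / e - 2 * (d ^ 2 / e ^ 3) := by ring
      rw [hL', h4]
      linarith
    rcases le_total (L' - e) 0 with h1 | h1
    · have : 0 ≤ d * (1 - d / e ^ 2) := mul_nonneg hd.le (by linarith)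
      nlinarith
    calc L * (L' - e) ≤ (e + d / e) * (L' - e) := by gcongr
      _ ≤ (e + d / e) * (d * (1 / e - 2 * d / e ^ 3)) := by gcongr
      _ = d * (1 - d / e ^ 2 - 2 * (d / e ^ 2) ^ 2) := by field_simp; ring
      _ ≤ d * (1 - d / e ^ 2) :=
        mul_le_mul_of_nonneg_left (by linarith [sq_nonneg (d / e ^ 2)]) hd.le
  nlinarith [mul_le_mul_of_nonneg_right h (sub_nonneg.2 hL1)]

/-- Two-sided bound on `1 / D`, in terms of `ε = 1 - l / λ` and `δ = 1 / λ`. -/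
lemma one_div_D_bounds {lam : ℝ} (hlam : 0 < lam) (l : ℕ)
    (hl : (l : ℝ) ≤ lam - √lam) :
    (1 - l / lam) + 1 / lam / (1 - l / lam)
        - 16 * (1 / lam + (1 / lam) ^ 2 / (1 - l / lam) ^ 3) ≤ 1 / D lam l ∧
      1 / D lam l ≤ (1 - l / lam) + 1 / lam / (1 - l / lam) := by
  have hd : 0 < 1 / lam := by positivity
  induction l with
  | zero =>
    simp only [D_zero, Nat.cast_zero, zero_div, sub_zero, div_one, one_pow]
    constructor
    · nlinarith
    · linarith
  | succ l ih =>
    push_cast at hl ⊢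
    obtain ⟨ih1, ih2⟩ := ih (by linarith)
    have hb : 0 < 1 / D lam l := one_div_pos.2 (D_pos hlam l)
    have hsq : √lam ^ 2 = lam := Real.sq_sqrt hlam.le
    have hsqrt : 0 < √lam := Real.sqrt_pos.2 hlam
    set e := 1 - ((l : ℝ) + 1) / lam with he_def
    have hprev : 1 - (l : ℝ) / lam = e + 1 / lam := by rw [he_def]; ring
    have he_eq : e = (lam - (l + 1)) / lam := by rw [he_def]; field_simp
    have he : 0 < e := by rw [he_eq]; exact div_pos (by linarith) hlam
    have he1 : e ≤ 1 := by
      have : 0 ≤ ((l : ℝ) + 1) / lam := by positivity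
      linarith
    have hde : 1 / lam ≤ e ^ 2 := by
      rw [he_eq, div_pow, div_le_div_iff₀ hlam (by positivity)]
      have : lam ≤ (lam - (l + 1)) ^ 2 := by nlinarith
      nlinarith
    rw [hprev] at ih1 ih2
    rw [one_div_D_succ hlam, show ((l : ℝ) + 1) / lam = 1 - e by rw [he_def]; ring]
    exact ⟨lower_step he he1 hd hde hb ih1, upper_step he he1 hd hb ih2⟩

/-- There are constants `C > 0`, `λ₀ > 0` such that for all `λ ≥ λ₀` and all naturals
`l ≤ λ − √λ`, `|1/D_λ(l) − (1 − l/λ) − 1/(λ(1 − l/λ))| ≤ C(1/λ + 1/(λ²(1 − l/λ)³))`. -/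
theorem body_estimate :
    ∃ C > (0 : ℝ), ∃ lam₀ > (0 : ℝ), ∀ lam : ℝ, lam₀ ≤ lam → ∀ l : ℕ,
      (l : ℝ) ≤ lam - Real.sqrt lam →
      |1 / D lam l - (1 - (l : ℝ) / lam) - 1 / (lam * (1 - (l : ℝ) / lam))|
        ≤ C * (1 / lam + 1 / (lam ^ 2 * (1 - (l : ℝ) / lam) ^ 3)) := by
  refine ⟨16, by norm_num, 1, one_pos, fun lam hlam l hl => ?_⟩
  have hpos : 0 < lam := by linarith
  obtain ⟨hlow, hup⟩ := one_div_D_bounds hpos l hl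
  have he : 0 ≤ 1 - (l : ℝ) / lam := by
    rw [sub_nonneg, div_le_one hpos]
    linarith [Real.sqrt_nonneg lam]
  rw [one_div_pow, div_div, div_div] at hlow
  rw [div_div] at hup
  have hC : 0 ≤ 1 / lam + 1 / (lam ^ 2 * (1 - (l : ℝ) / lam) ^ 3) := by positivity
  rw [abs_le]
  constructor <;> linarith
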